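/- Fix g_1, g_2, h in the free group F_K with |g_1| = |g_2|, and fix m > 2·max(|g_1|, |h|). For k_1, k_2 ∈ F_K, if the sets S^m(k_1,g_1) ∩ T^m(k_2,h) and S^m(k_1,g_2) ∩ T^m(k_2,h) are both nonempty or the relevant inner products are nonzero, then with k_1 fixed there are at most (2K)^{|h|+|g_1|} possible values of k_2, and symmetrically with k_2 fixed at most (2K)^{|h|+|g_1|} possible values of k_1. -/

import Mathlib

open FreeGroup

/-- `wordSetS K m k g` is the set `S^m(k,g)` of all elements of `F_K` of the form
`x·k·y·g` with `|x| = |y| = m` and no cancelations in the products `xk` and `ky`. -/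
def wordSetS (K m : ℕ) (k g : FreeGroup (Fin K)) : Set (FreeGroup (Fin K)) :=
  {w | ∃ x y : FreeGroup (Fin K), w = x * k * y * g ∧ norm x = m ∧ norm y = m ∧
    norm (x * k) = m + norm k ∧ norm (k * y) = norm k + m}

/-- `wordSetT K m k h` is the set `T^m(k,h)` of all elements of `F_K` of the form
`h·x·k·y` with `|x| = |y| = m` and no cancelations in the products `xk` and `ky`. -/
def wordSetT (K m : ℕ) (k h : FreeGroup (Fin K)) : Set (FreeGroup (Fin K)) :=
  {w | ∃ x y : FreeGroup (Fin K), w = h * x * k * y ∧ norm x = m ∧ norm y = m ∧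
    norm (x * k) = m + norm k ∧ norm (k * y) = norm k + m}

/-- The element represented by the first `m` letters of the reduced word of `w`. -/
def pre {K : ℕ} (m : ℕ) (w : FreeGroup (Fin K)) : FreeGroup (Fin K) :=
  mk (w.toWord.take m)

lemma norm_mul_letter_ge {K : ℕ} (s : Fin K × Bool) (w : FreeGroup (Fin K)) :
    norm w ≤ norm (w * mk [s]) + 1 := by
  have h := norm_mul_le (w * mk [s]) (mk [s])⁻¹
  rw [mul_inv_cancel_right, norm_inv_eq] at h
  have h2 : norm (mk [s]) ≤ 1 := norm_mk_le
  omega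

lemma norm_letter_mul_ge {K : ℕ} (s : Fin K × Bool) (w : FreeGroup (Fin K)) :
    norm w ≤ norm (mk [s] * w) + 1 := by
  have h := norm_mul_le (mk [s])⁻¹ (mk [s] * w)
  rw [inv_mul_cancel_left, norm_inv_eq] at h
  have h2 : norm (mk [s]) ≤ 1 := norm_mk_le
  omega

lemma toWord_mul_of_norm {K : ℕ} {a b : FreeGroup (Fin K)}
    (h : norm (a * b) = norm a + norm b) : (a * b).toWord = a.toWord ++ b.toWord := by
  apply (toWord_mul_sublist a b).eq_of_length
  simpa [FreeGroup.norm] using h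

lemma mk_cons {K : ℕ} (s : Fin K × Bool) (L : List (Fin K × Bool)) :
    mk (s :: L) = mk [s] * mk L := by
  rw [mul_mk, List.singleton_append]

lemma pre_letter_mul {K m : ℕ} (s : Fin K × Bool) (w : FreeGroup (Fin K))
    (hw : m + 1 ≤ norm w) :
    ∃ l : Fin K × Bool, mk [s] * pre m w = pre m (mk [s] * w) * mk [l] := by
  have e : (mk [s] * w).toWord = reduce (s :: w.toWord) := by
    rw [toWord_mul, toWord_mk]; rfl
  have hred : reduce w.toWord = w.toWord := reduce_toWord w
  unfold pre
  rw [e, reduce.cons, hred]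
  unfold FreeGroup.norm at hw
  generalize w.toWord = W at *
  match W, hw with
  | hd :: tl, hw =>
    simp only
    split_ifs with hc
    · have hlt : m < (hd :: tl).length := by omega
      have h1 := List.take_append_getElem hlt
      rw [List.take_succ_cons] at h1
      refine ⟨(((hd :: tl)[m]).1, !((hd :: tl)[m]).2), ?_⟩
      have hinv : ∀ t : Fin K × Bool, mk [(t.1, !t.2)] = (mk [t])⁻¹ := by
        intro t; simp [inv_mk, invRev]
      have hs : mk [s] = (mk [hd])⁻¹ := by
        rw [← hinv]; congr 2; exact Prod.ext hc.1 hc.2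
      have h2 := congrArg (mk (α := Fin K)) h1
      rw [← mul_mk, mk_cons hd] at h2
      rw [hinv, hs, eq_mul_inv_iff_mul_eq, mul_assoc, h2, inv_mul_cancel_left]
    · have hlt : m < (s :: hd :: tl).length := by simp at hw ⊢; omega
      have h1 := List.take_append_getElem hlt
      rw [List.take_succ_cons] at h1
      refine ⟨(s :: hd :: tl)[m], ?_⟩
      have h2 := congrArg (mk (α := Fin K)) h1
      rw [← mul_mk, mk_cons s] at h2
      exact h2.symm

lemma pre_mul_letter {K m : ℕ} (s : Fin K × Bool) (w : FreeGroup (Fin K))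
    (hw : m + 1 ≤ norm w) : pre m (w * mk [s]) = pre m w := by
  have hne : w.toWord ≠ [] := by
    intro h; simp [FreeGroup.norm, h] at hw
  obtain ⟨A, t, hA⟩ : ∃ A t, w.toWord = A ++ [t] :=
    ⟨_, _, (List.dropLast_append_getLast hne).symm⟩
  have hr : IsReduced (A ++ [t]) := hA ▸ isReduced_toWord
  have hlen : m ≤ A.length := by
    simp [FreeGroup.norm, hA] at hw; exact hw
  have e : w * mk [s] = mk (A ++ [t] ++ [s]) := by
    rw [← mul_mk, ← hA, mk_toWord]
  unfold pre
  congr 1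
  rw [hA]
  by_cases hc : t.1 = s.1 ∧ s.2 = !t.2
  · have : mk (A ++ [t] ++ [s]) = mk A := by
      rw [← mul_mk, ← mul_mk, mul_assoc]
      have : mk [s] = (mk [t])⁻¹ := by
        rw [show s = (t.1, !t.2) from Prod.ext hc.1.symm hc.2]
        simp [inv_mk, invRev]
      rw [this, mul_inv_cancel, mul_one]
    rw [e, this, toWord_mk, IsReduced.reduce_eq (List.IsChain.left_of_append hr),
      List.take_append_of_le_length hlen]
  · have : IsReduced (A ++ [t] ++ [s]) := by
      apply IsReduced.append_overlap hr _ (by simp)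
      simp only [List.singleton_append, FreeGroup.isReduced_cons_cons, FreeGroup.IsReduced.singleton, and_true]
      intro h
      by_contra h2
      apply hc
      refine ⟨h, ?_⟩
      revert h2
      cases t.2 <;> cases s.2 <;> simp
    rw [e, toWord_mk, this.reduce_eq, List.append_assoc, List.take_append_of_le_length hlen,
      List.take_append_of_le_length hlen]

lemma pre_word_mul {K m : ℕ} (P : List (Fin K × Bool)) (w : FreeGroup (Fin K))
    (hw : m + P.length ≤ norm w) :
    ∃ Q : List (Fin K × Bool), Q.length = P.length ∧
      mk P * pre m w = pre m (mk P * w) * mk Q := by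
  induction P with
  | nil => exact ⟨[], rfl, by simp [← one_eq_mk]⟩
  | cons s P ih =>
    simp only [List.length_cons] at hw
    obtain ⟨Q, hQ, hQ2⟩ := ih (by omega)
    have hn : m + 1 ≤ norm (mk P * w) := by
      have h := norm_mul_le (mk P)⁻¹ (mk P * w)
      rw [inv_mul_cancel_left, norm_inv_eq] at h
      have h2 : norm (mk P) ≤ P.length := norm_mk_le
      omega
    obtain ⟨l, hl⟩ := pre_letter_mul s (mk P * w) hn
    refine ⟨l :: Q, by simp [hQ], ?_⟩
    rw [← List.singleton_append, ← mul_mk, mul_assoc, hQ2, ← mul_assoc, hl,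
      mul_assoc, mul_mk (L₁ := [l]), List.singleton_append, mul_assoc]

lemma pre_mul_word {K m : ℕ} (P : List (Fin K × Bool)) (w : FreeGroup (Fin K))
    (hw : m + P.length ≤ norm w) : pre m (w * mk P) = pre m w := by
  induction P generalizing w with
  | nil => simp [← one_eq_mk]
  | cons s P ih =>
    simp only [List.length_cons] at hw
    have := norm_mul_letter_ge s w
    rw [← List.singleton_append, ← mul_mk, ← mul_assoc, ih _ (by omega),
      pre_mul_letter s w (by omega)]

lemma parity_mul {K : ℕ} (a b : FreeGroup (Fin K)) :
    norm (a * b) % 2 = (norm a + norm b) % 2 := by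
  obtain ⟨n, hn⟩ := (reduce.red (L := a.toWord ++ b.toWord)).length
  rw [← toWord_mul, List.length_append] at hn
  unfold FreeGroup.norm
  omega

lemma exists_word {K : ℕ} (hK : 2 ≤ K) (z : FreeGroup (Fin K)) (n : ℕ)
    (h1 : norm z ≤ n) (h2 : norm z % 2 = n % 2) :
    ∃ L : List (Fin K × Bool), L.length = n ∧ z = mk L := by
  obtain ⟨j, rfl⟩ : ∃ j, n = norm z + 2 * j := ⟨(n - norm z) / 2, by omega⟩
  clear h1 h2
  induction j with
  | zero => exact ⟨z.toWord, rfl, mk_toWord.symm⟩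
  | succ j ih =>
    obtain ⟨L, hL, hz⟩ := ih
    refine ⟨[(⟨0, by omega⟩, true), (⟨0, by omega⟩, false)] ++ L, by simp [hL]; ring, ?_⟩
    rw [← mul_mk, ← hz]
    have : mk [((⟨0, by omega⟩ : Fin K), true), (⟨0, by omega⟩, false)] = 1 := by
      rw [← toWord_eq_nil_iff, toWord_mk]; simp [reduce.cons]
    rw [this, one_mul]

lemma toWord_triple {K : ℕ} {x k y : FreeGroup (Fin K)} (hk : k ≠ 1)
    (h1 : norm (x * k) = norm x + norm k) (h2 : norm (k * y) = norm k + norm y) :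
    (x * k * y).toWord = x.toWord ++ k.toWord ++ y.toWord := by
  have e1 := toWord_mul_of_norm h1
  have e2 := toWord_mul_of_norm h2
  have r1 : IsReduced (x.toWord ++ k.toWord) := e1 ▸ isReduced_toWord
  have r2 : IsReduced (k.toWord ++ y.toWord) := e2 ▸ isReduced_toWord
  have r := IsReduced.append_overlap r1 r2 (by simpa using hk)
  rw [toWord_mul, e1, r.reduce_eq]

lemma norm_triple {K m : ℕ} {x k y : FreeGroup (Fin K)} (hk : k ≠ 1)
    (hx : norm x = m) (hy : norm y = m)
    (h1 : norm (x * k) = m + norm k) (h2 : norm (k * y) = norm k + m) :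
    norm (x * k * y) = 2 * m + norm k := by
  have := toWord_triple hk (by rw [h1, hx]) (by rw [h2, hy])
  simp only [FreeGroup.norm] at *
  rw [this]; simp; omega

lemma pre_triple {K m : ℕ} {x k y : FreeGroup (Fin K)} (hk : k ≠ 1)
    (hx : norm x = m) (hy : norm y = m)
    (h1 : norm (x * k) = m + norm k) (h2 : norm (k * y) = norm k + m) :
    pre m (x * k * y) = x := by
  have := toWord_triple hk (by rw [h1, hx]) (by rw [h2, hy])
  unfold pre
  rw [this, List.append_assoc, List.take_left' hx, mk_toWord]

lemma pre_triple_inv {K m : ℕ} {x k y : FreeGroup (Fin K)} (hk : k ≠ 1)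
    (hx : norm x = m) (hy : norm y = m)
    (h1 : norm (x * k) = m + norm k) (h2 : norm (k * y) = norm k + m) :
    pre m (x * k * y)⁻¹ = y⁻¹ := by
  have e : (x * k * y)⁻¹ = y⁻¹ * k⁻¹ * x⁻¹ := by group
  rw [e]
  apply pre_triple (by simpa using hk) (by simpa using hy) (by simpa using hx)
  · rw [← mul_inv_rev, norm_inv_eq, norm_inv_eq, h2, add_comm]
  · rw [← mul_inv_rev, norm_inv_eq, norm_inv_eq, h1, add_comm]

/-- The two words differ by multiplication by words of prescribed length on both sides. -/
def WRel {K : ℕ} (a b : ℕ) (k₁ k₂ : FreeGroup (Fin K)) : Prop :=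
  ∃ P Q : List (Fin K × Bool), P.length = a ∧ Q.length = b ∧ k₂ = mk P * k₁ * mk Q

lemma WRel.symm {K a b : ℕ} {k₁ k₂ : FreeGroup (Fin K)} (h : WRel a b k₁ k₂) : WRel a b k₂ k₁ := by
  obtain ⟨P, Q, hP, hQ, rfl⟩ := h
  refine ⟨invRev P, invRev Q, by simpa, by simpa, ?_⟩
  rw [← inv_mk, ← inv_mk]; group

lemma WRel.of_one {K a b : ℕ} (hK : 2 ≤ K) {k : FreeGroup (Fin K)} (h1 : norm k ≤ a + b)
    (h2 : norm k % 2 = (a + b) % 2) : WRel a b 1 k := by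
  obtain ⟨L, hL, rfl⟩ := exists_word hK k _ h1 h2
  refine ⟨L.take a, L.drop a, by simp; omega, by simp; omega, ?_⟩
  rw [mul_one, mul_mk, List.take_append_drop]

lemma WRel.ncard_le {K a b : ℕ} (k : FreeGroup (Fin K)) (S : Set (FreeGroup (Fin K)))
    (hS : ∀ k' ∈ S, WRel a b k k') : S.ncard ≤ (2 * K) ^ (a + b) := by
  classical
  let f : List.Vector (Fin K × Bool) a × List.Vector (Fin K × Bool) b → FreeGroup (Fin K) :=
    fun p => mk p.1.1 * k * mk p.2.1
  have hsub : S ⊆ Set.range f := by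
    intro k' hk'
    obtain ⟨P, Q, hP, hQ, rfl⟩ := hS k' hk'
    exact ⟨(⟨P, hP⟩, ⟨Q, hQ⟩), rfl⟩
  refine (Set.ncard_le_ncard hsub (Set.finite_range f)).trans ?_
  rw [← Set.image_univ]
  refine (Set.ncard_image_le Set.finite_univ).trans ?_
  rw [Set.ncard_univ, Nat.card_eq_fintype_card]
  simp [pow_add, mul_comm]

set_option maxHeartbeats 2000000 in
lemma rel_of_inter {K m : ℕ} (hK : 2 ≤ K) {g h k₁ k₂ : FreeGroup (Fin K)}
    (hg : 2 * norm g < m) (hh : 2 * norm h < m)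
    (H : (wordSetS K m k₁ g ∩ wordSetT K m k₂ h).Nonempty) :
    WRel (norm h) (norm g) k₁ k₂ := by
  obtain ⟨w, ⟨x, y, rfl, hx, hy, h1, h2⟩, ⟨x', y', hw, hx', hy', h1', h2'⟩⟩ := H
  have hV : x' * k₂ * y' = h⁻¹ * (x * k₁ * y) * g := by
    have : h⁻¹ * (x * k₁ * y) * g = h⁻¹ * (x * k₁ * y * g) := by group
    rw [this, hw]; group
  have hU : x * k₁ * y = h * (x' * k₂ * y') * g⁻¹ := by rw [hV]; group
  have p1 := parity_mul (h⁻¹ * (x * k₁ * y)) g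
  have p2 := parity_mul h⁻¹ (x * k₁ * y)
  have p3 := parity_mul (x * k₁) y
  have p4 := parity_mul (x' * k₂) y'
  rw [← hV] at p1
  rw [norm_inv_eq] at p2
  have n1 := norm_mul_le (h⁻¹ * (x * k₁ * y)) g
  have n2 := norm_mul_le h⁻¹ (x * k₁ * y)
  have n3 := norm_mul_le (x * k₁) y
  have n4 := norm_mul_le (h * (x' * k₂ * y')) g⁻¹
  have n5 := norm_mul_le h (x' * k₂ * y')
  have n6 := norm_mul_le (x' * k₂) y'
  rw [← hV] at n1
  rw [← hU] at n4
  rw [norm_inv_eq] at n2 n4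
  by_cases hk1 : k₁ = 1
  · subst hk1
    have n0 : FreeGroup.norm (1 : FreeGroup (Fin K)) = 0 := norm_one
    apply WRel.of_one hK
    · by_cases hk2 : k₂ = 1
      · simp [hk2]
      · have := norm_triple hk2 hx' hy' h1' h2'
        omega
    · omega
  by_cases hk2 : k₂ = 1
  · subst hk2
    have n0 : FreeGroup.norm (1 : FreeGroup (Fin K)) = 0 := norm_one
    apply WRel.symm
    apply WRel.of_one hK
    · have := norm_triple hk1 hx hy h1 h2
      omega
    · omega
  have nU := norm_triple hk1 hx hy h1 h2
  have a1 := pre_triple hk1 hx hy h1 h2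
  have a2 := pre_triple_inv hk1 hx hy h1 h2
  have b1 := pre_triple hk2 hx' hy' h1' h2'
  have b2 := pre_triple_inv hk2 hx' hy' h1' h2'
  have hV' : (x' * k₂ * y')⁻¹ = g⁻¹ * (x * k₁ * y)⁻¹ * h := by rw [hV]; group
  have hkey : k₂ = x'⁻¹ * (x' * k₂ * y') * y'⁻¹ := by group
  have hkU : k₁ = x⁻¹ * (x * k₁ * y) * y⁻¹ := by group
  generalize x * k₁ * y = U at *
  generalize x' * k₂ * y' = V at *
  have aux : ∀ u v W : FreeGroup (Fin K), m + norm u + norm v ≤ norm W →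
      ∃ Q : List (Fin K × Bool), Q.length = norm u ∧
        u * pre m W = pre m (u * W * v) * mk Q := by
    intro u v W hW
    obtain ⟨Q, hQ, hQ2⟩ := pre_word_mul (m := m) u.toWord W (by unfold FreeGroup.norm at *; omega)
    rw [mk_toWord] at hQ2
    have n := norm_mul_le u⁻¹ (u * W)
    rw [inv_mul_cancel_left, norm_inv_eq] at n
    have := pre_mul_word (m := m) v.toWord (u * W) (by unfold FreeGroup.norm at *; omega)
    rw [mk_toWord] at this
    exact ⟨Q, hQ, by rw [this, hQ2]⟩
  obtain ⟨P, hP, hP2⟩ := aux h⁻¹ g U (by rw [norm_inv_eq]; omega)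
  obtain ⟨Q, hQ, hQ2⟩ := aux g⁻¹ h U⁻¹ (by rw [norm_inv_eq, norm_inv_eq]; omega)
  rw [← hV, a1, b1] at hP2
  rw [← hV', a2, b2] at hQ2
  rw [norm_inv_eq] at hP hQ
  refine ⟨P, invRev Q, hP, by simpa, ?_⟩
  have eP : mk P = x'⁻¹ * (h⁻¹ * x) := by rw [hP2]; group
  have eQ : mk Q = y' * (g⁻¹ * y⁻¹) := by rw [hQ2]; group
  rw [← inv_mk, eP, eQ, hkey, hkU, hV]
  group

/-- Fix `g₁, g₂, h ∈ F_K` with `|g₁| = |g₂|` and `m > 2·max(|g₁|,|h|)`.  For fixed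
`k₁`, there are at most `(2K)^{|h|+|g₁|}` elements `k₂` for which
`S^m(k₁,g₁) ∩ T^m(k₂,h)` or `S^m(k₁,g₂) ∩ T^m(k₂,h)` is nonempty, and symmetrically
with the roles of `k₁` and `k₂` exchanged. -/
theorem count_interacting_words (K : ℕ) (hK : 2 ≤ K)
    (g₁ g₂ h : FreeGroup (Fin K)) (hg : norm g₁ = norm g₂)
    (m : ℕ) (hm : 2 * max (norm g₁) (norm h) < m) :
    (∀ k₁ : FreeGroup (Fin K),
      Set.ncard {k₂ : FreeGroup (Fin K) |
          (wordSetS K m k₁ g₁ ∩ wordSetT K m k₂ h).Nonempty ∨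
          (wordSetS K m k₁ g₂ ∩ wordSetT K m k₂ h).Nonempty}
        ≤ (2 * K) ^ (norm h + norm g₁)) ∧
    (∀ k₂ : FreeGroup (Fin K),
      Set.ncard {k₁ : FreeGroup (Fin K) |
          (wordSetS K m k₁ g₁ ∩ wordSetT K m k₂ h).Nonempty ∨
          (wordSetS K m k₁ g₂ ∩ wordSetT K m k₂ h).Nonempty}
        ≤ (2 * K) ^ (norm h + norm g₁)) := by
  have m1 := le_max_left (norm g₁) (norm h)
  have m2 := le_max_right (norm g₁) (norm h)
  have key : ∀ k₁ k₂ : FreeGroup (Fin K),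
      ((wordSetS K m k₁ g₁ ∩ wordSetT K m k₂ h).Nonempty ∨
          (wordSetS K m k₁ g₂ ∩ wordSetT K m k₂ h).Nonempty) →
      WRel (norm h) (norm g₁) k₁ k₂ := by
    rintro k₁ k₂ (H | H)
    · exact rel_of_inter hK (by omega) (by omega) H
    · rw [hg]
      exact rel_of_inter hK (by omega) (by omega) H
  exact ⟨fun k₁ => WRel.ncard_le k₁ _ fun k₂ hk => key k₁ k₂ hk,
    fun k₂ => WRel.ncard_le k₂ _ fun k₁ hk => (key k₁ k₂ hk).symm⟩
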